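/- arXiv:0902.1324 — 2 statements merged into one kernel-verified Lean document; each statement's English description precedes it below -/
import Mathlib

section
/- The eigenvalue relaxation majorizes the SDP relaxation: for every real symmetric positive semidefinite (n+1)×(n+1) matrix X with diag(X) = e and every u ∈ ℝ^{n+1}, trace(−MX) ≤ (n+1)·λmax( −M + D(u) − (eᵀu/(n+1))·I ) = θ(u). -/
open Matrix

noncomputable section

/-- The largest eigenvalue of a real (symmetric) matrix, i.e. the supremum of its spectrum. -/
def lamMax {k : Type*} [Fintype k] [DecidableEq k] (S : Matrix k k ℝ) : ℝ :=
  sSup (spectrum ℝ S)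

/-- The block matrix `M = [[AᵀA + νP, −Aᵀy], [−yᵀA, yᵀy]]`, acting on `ℝ^{n+1} = ℝ^n ⊕ ℝ`. -/
def Mmat {m n : ℕ} (A : Matrix (Fin m) (Fin n) ℝ) (y : Fin m → ℝ) (ν : ℝ)
    (P : Matrix (Fin n) (Fin n) ℝ) : Matrix (Fin n ⊕ Unit) (Fin n ⊕ Unit) ℝ :=
  Matrix.fromBlocks (Aᵀ * A + ν • P)
    (Matrix.of fun i (_ : Unit) => -(Aᵀ *ᵥ y) i)
    (Matrix.of fun (_ : Unit) j => -(Aᵀ *ᵥ y) j)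
    (Matrix.of fun _ _ => y ⬝ᵥ y)

/-- The matrix `A(u) = D(u) − M − (uᵀe/(n+1))·I`. -/
def Amat {m n : ℕ} (A : Matrix (Fin m) (Fin n) ℝ) (y : Fin m → ℝ) (ν : ℝ)
    (P : Matrix (Fin n) (Fin n) ℝ) (u : Fin n ⊕ Unit → ℝ) :
    Matrix (Fin n ⊕ Unit) (Fin n ⊕ Unit) ℝ :=
  Matrix.diagonal u - Mmat A y ν P - ((u ⬝ᵥ (fun _ => 1)) / (n + 1 : ℝ)) • 1

/-- The dual function `θ(u) = (n+1)·λmax(A(u))`. -/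
def theta {m n : ℕ} (A : Matrix (Fin m) (Fin n) ℝ) (y : Fin m → ℝ) (ν : ℝ)
    (P : Matrix (Fin n) (Fin n) ℝ) (u : Fin n ⊕ Unit → ℝ) : ℝ :=
  (n + 1 : ℝ) * lamMax (Amat A y ν P u)

/-- The set of values `−xᵀMx` over binary vectors `x ∈ {−1,1}^{n+1}`;
its supremum (a maximum) is `opt(BLS)`. -/
def BLSvals {n : ℕ} (M : Matrix (Fin n ⊕ Unit) (Fin n ⊕ Unit) ℝ) : Set ℝ :=
  {t | ∃ x : Fin n ⊕ Unit → ℝ, (∀ i, x i = 1 ∨ x i = -1) ∧ t = -(x ⬝ᵥ (M *ᵥ x))}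

namespace Matrix

variable {k : Type*} [Fintype k] [DecidableEq k]

lemma IsHermitian.posSemidef_lamMax_smul_one_sub {S : Matrix k k ℝ} (hS : S.IsHermitian) :
    (lamMax S • (1 : Matrix k k ℝ) - S).PosSemidef := by
  rw [posSemidef_iff_isHermitian_and_spectrum_nonneg]
  refine ⟨(isHermitian_one.smul (IsSelfAdjoint.all (lamMax S))).sub hS, ?_⟩
  rw [← Algebra.algebraMap_eq_smul_one, ← spectrum.singleton_sub_eq]
  rintro _ ⟨_, rfl, t, ht, rfl⟩
  exact sub_nonneg.2 (le_csSup finite_real_spectrum.bddAbove ht)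

open scoped MatrixOrder in
lemma PosSemidef.trace_mul_nonneg {S X : Matrix k k ℝ} (hS : S.PosSemidef)
    (hX : X.PosSemidef) : 0 ≤ (S * X).trace := by
  obtain ⟨B, rfl⟩ := CStarAlgebra.nonneg_iff_eq_star_mul_self.mp hX.nonneg
  rw [← Matrix.mul_assoc, trace_mul_comm, ← Matrix.mul_assoc]
  exact (hS.mul_mul_conjTranspose_same B).trace_nonneg

lemma IsHermitian.trace_mul_le_lamMax_mul_trace {S X : Matrix k k ℝ} (hS : S.IsHermitian)
    (hX : X.PosSemidef) : (S * X).trace ≤ lamMax S * X.trace := by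
  have h := hS.posSemidef_lamMax_smul_one_sub.trace_mul_nonneg hX
  rw [sub_mul, trace_sub, smul_mul, one_mul, trace_smul, smul_eq_mul] at h
  linarith

end Matrix

lemma Mmat_isHermitian {m n : ℕ} (A : Matrix (Fin m) (Fin n) ℝ) (y : Fin m → ℝ) (ν : ℝ)
    {P : Matrix (Fin n) (Fin n) ℝ} (hP : P.IsSymm) : (Mmat A y ν P).IsHermitian := by
  refine IsHermitian.fromBlocks ?_ rfl rfl
  rw [IsHermitian, conjTranspose_eq_transpose_of_trivial, transpose_add, transpose_mul,
    transpose_transpose, transpose_smul, hP.eq]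

/-- The eigenvalue relaxation majorizes the SDP relaxation: for every feasible
SDP matrix `X` (`X ⪰ 0`, `diag(X) = e`) and every `u`,
`trace(−MX) ≤ (n+1)·λmax(−M + D(u) − (eᵀu/(n+1))·I) = θ(u)`. -/
theorem eigenvalue_relaxation_majorizes_sdp {m n : ℕ} (A : Matrix (Fin m) (Fin n) ℝ)
    (y : Fin m → ℝ) (ν : ℝ) (hν : 0 ≤ ν) (P : Matrix (Fin n) (Fin n) ℝ) (hP : P.IsSymm)
    (X : Matrix (Fin n ⊕ Unit) (Fin n ⊕ Unit) ℝ) (hX : X.PosSemidef)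
    (hdiag : ∀ i, X.diag i = 1) (u : Fin n ⊕ Unit → ℝ) :
    ((-(Mmat A y ν P)) * X).trace ≤
      (n + 1 : ℝ) * lamMax
        (-(Mmat A y ν P) + Matrix.diagonal u - (((fun _ => (1:ℝ)) ⬝ᵥ u) / (n + 1 : ℝ)) • 1) ∧
    (n + 1 : ℝ) * lamMax
        (-(Mmat A y ν P) + Matrix.diagonal u - (((fun _ => (1:ℝ)) ⬝ᵥ u) / (n + 1 : ℝ)) • 1)
      = theta A y ν P u := by
  have hS : (-(Mmat A y ν P) + Matrix.diagonal u -
      (((fun _ => (1:ℝ)) ⬝ᵥ u) / (n + 1 : ℝ)) • 1).IsHermitian :=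
    ((Mmat_isHermitian A y ν hP).neg.add (isHermitian_diagonal u)).sub
      (isHermitian_one.smul (IsSelfAdjoint.all _))
  have htr : X.trace = n + 1 := by
    simp only [Matrix.trace, hdiag]
    simp
  have hD : (Matrix.diagonal u * X).trace = (fun _ => (1:ℝ)) ⬝ᵥ u := by
    simp only [Matrix.trace, dotProduct, diag_apply, diagonal_mul] at hdiag ⊢
    simp [hdiag]
  constructor
  · have h := hS.trace_mul_le_lamMax_mul_trace hX
    rw [sub_mul, add_mul, trace_sub, trace_add, hD, smul_mul, one_mul, trace_smul, htr,
      smul_eq_mul, div_mul_cancel₀ _ (by positivity)] at h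
    linarith
  · rw [theta, Amat, dotProduct_comm u, sub_eq_add_neg (Matrix.diagonal u),
      add_comm (Matrix.diagonal u)]
end
end

section
/- Subgradient from a single top eigenvector: let u ∈ ℝ^{n+1} and let x ∈ ℝ^{n+1} satisfy xᵀx = n+1 and A(u)x = λmax(A(u))·x, where A(u) = D(u) − M − (uᵀe/(n+1))·I. Then the vector g = (x_1² − 1, …, x_{n+1}² − 1)ᵀ is a subgradient of θ at u, i.e. θ(u') ≥ θ(u) + ⟨g, u' − u⟩ for all u' ∈ ℝ^{n+1}. -/
open Matrix

noncomputable section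

/-- The Rayleigh quotient of a real symmetric matrix is at most its largest eigenvalue. -/
lemma dotProduct_mulVec_le_lamMax {k : Type*} [Fintype k] [DecidableEq k] {S : Matrix k k ℝ}
    (hS : S.IsHermitian) (x : k → ℝ) : x ⬝ᵥ (S *ᵥ x) ≤ lamMax S * (x ⬝ᵥ x) := by
  have hpsd : (algebraMap ℝ (Matrix k k ℝ) (lamMax S) - S).PosSemidef := by
    refine posSemidef_iff_isHermitian_and_spectrum_nonneg.mpr ⟨?_, ?_⟩
    · exact (isHermitian_diagonal _).sub hS
    · rw [← spectrum.singleton_sub_eq]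
      rintro _ ⟨_, rfl, b, hb, rfl⟩
      exact sub_nonneg.mpr (le_csSup (finite_real_spectrum (A := S)).bddAbove hb)
  have h := hpsd.dotProduct_mulVec_nonneg x
  rw [Algebra.algebraMap_eq_smul_one, sub_mulVec, smul_mulVec, one_mulVec, dotProduct_sub,
    dotProduct_smul, star_trivial, smul_eq_mul] at h
  linarith

lemma isSymm_Mmat {m n : ℕ} (A : Matrix (Fin m) (Fin n) ℝ) (y : Fin m → ℝ) (ν : ℝ)
    {P : Matrix (Fin n) (Fin n) ℝ} (hP : P.IsSymm) : (Mmat A y ν P).IsSymm := by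
  refine IsSymm.fromBlocks ?_ rfl rfl
  have hA : (Aᵀ * A).IsSymm := by rw [IsSymm, transpose_mul, transpose_transpose]
  exact hA.add (hP.smul ν)

lemma isHermitian_Amat {m n : ℕ} (A : Matrix (Fin m) (Fin n) ℝ) (y : Fin m → ℝ) (ν : ℝ)
    {P : Matrix (Fin n) (Fin n) ℝ} (hP : P.IsSymm) (u : Fin n ⊕ Unit → ℝ) :
    (Amat A y ν P u).IsHermitian := by
  rw [IsHermitian, conjTranspose_eq_transpose_of_trivial]
  exact ((isSymm_diagonal u).sub (isSymm_Mmat A y ν hP)).sub (isSymm_one.smul _)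

lemma dotProduct_Amat_mulVec {m n : ℕ} (A : Matrix (Fin m) (Fin n) ℝ) (y : Fin m → ℝ) (ν : ℝ)
    (P : Matrix (Fin n) (Fin n) ℝ) (u : Fin n ⊕ Unit → ℝ) {x : Fin n ⊕ Unit → ℝ}
    (hx : x ⬝ᵥ x = (n + 1 : ℝ)) :
    x ⬝ᵥ (Amat A y ν P u *ᵥ x) =
      (fun i => (x i) ^ 2 - 1) ⬝ᵥ u - x ⬝ᵥ (Mmat A y ν P *ᵥ x) := by
  have hn : (n + 1 : ℝ) ≠ 0 := by positivity
  have hdiag : x ⬝ᵥ (diagonal u *ᵥ x) - u ⬝ᵥ (fun _ => 1) = (fun i => (x i) ^ 2 - 1) ⬝ᵥ u := by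
    simp only [dotProduct, mulVec_diagonal, ← Finset.sum_sub_distrib]
    exact Finset.sum_congr rfl fun i _ => by ring
  rw [Amat, sub_mulVec, sub_mulVec, smul_mulVec, one_mulVec, dotProduct_sub, dotProduct_sub,
    dotProduct_smul, hx, smul_eq_mul, div_mul_cancel₀ _ hn, ← hdiag]
  ring

/-- subgradient from a single top eigenvector: if `xᵀx = n+1` and
`A(u)x = λmax(A(u))·x`, then `g = (x₁² − 1, …, x_{n+1}² − 1)ᵀ` is a subgradient of `θ` at
`u`: `θ(u') ≥ θ(u) + ⟨g, u' − u⟩` for all `u'`. -/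
theorem subgradient_from_top_eigenvector {m n : ℕ} (A : Matrix (Fin m) (Fin n) ℝ)
    (y : Fin m → ℝ) (ν : ℝ) (hν : 0 ≤ ν) (P : Matrix (Fin n) (Fin n) ℝ) (hP : P.IsSymm)
    (u : Fin n ⊕ Unit → ℝ) (x : Fin n ⊕ Unit → ℝ)
    (hx : x ⬝ᵥ x = (n + 1 : ℝ))
    (heig : Amat A y ν P u *ᵥ x = lamMax (Amat A y ν P u) • x) :
    ∀ u' : Fin n ⊕ Unit → ℝ,
      theta A y ν P u + (fun i => (x i) ^ 2 - 1) ⬝ᵥ (u' - u) ≤ theta A y ν P u' := by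
  intro u'
  have hle := dotProduct_mulVec_le_lamMax (isHermitian_Amat A y ν hP u') x
  have heq := dotProduct_Amat_mulVec A y ν P u hx
  rw [heig, dotProduct_smul, smul_eq_mul, hx] at heq
  rw [dotProduct_Amat_mulVec A y ν P u' hx, hx] at hle
  rw [theta, theta, dotProduct_sub]
  linarith
end
end
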